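/- Let f : ℂ^k → ℂ^k be a regular polynomial endomorphism of degree d ≥ 2 and G(z) = lim_n d^{-n} log⁺|f^n(z)| its Green function, and let f_h be the homogeneous part of degree d with homogeneous Green function G_h. Then G(z) − G_h(z) → 0 as |z| → ∞; equivalently, writing ρ_G(z) = G_h(z/|z|), one has G(z) = log|z| + ρ_G(z) + o(1) as |z| → ∞. -/

import Mathlib

open Filter

/-- Evaluation of a `k`-tuple of polynomials in `k` variables as a self-map of `ℂ^k`. -/
noncomputable def evalMap {k : ℕ} (F : Fin k → MvPolynomial (Fin k) ℂ)
    (z : EuclideanSpace ℂ (Fin k)) : EuclideanSpace ℂ (Fin k) :=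
  (WithLp.equiv 2 (Fin k → ℂ)).symm fun i =>
    MvPolynomial.eval ((WithLp.equiv 2 (Fin k → ℂ)) z) (F i)


lemma seq_bound (d : ℝ) (hd : 2 ≤ d) (C : ℝ) (L : ℕ → ℝ) (g : ℝ)
    (hL : ∀ n, |L (n+1) - d * L n| ≤ C)
    (hg : Tendsto (fun n => (d ^ n)⁻¹ * L n) atTop (nhds g)) (n : ℕ) :
    |(d ^ n)⁻¹ * L n - g| ≤ C / d / (1 - d⁻¹) * d⁻¹ ^ n := by
  have hd0 : 0 < d := by linarith
  have h := dist_le_of_le_geometric_of_tendsto d⁻¹ (C / d)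
    (inv_lt_one_of_one_lt₀ (by linarith)) (f := fun n => (d ^ n)⁻¹ * L n) (a := g) ?_ hg n
  · rw [Real.dist_eq] at h
    refine h.trans (le_of_eq ?_)
    ring
  · intro n
    rw [dist_comm, Real.dist_eq]
    have : (d ^ (n+1))⁻¹ * L (n+1) - (d ^ n)⁻¹ * L n
        = (d ^ (n+1))⁻¹ * (L (n+1) - d * L n) := by
      field_simp
      ring
    rw [this, abs_mul, abs_of_pos (by positivity)]
    have h2 := mul_le_mul_of_nonneg_left (hL n) (show 0 ≤ (d ^ (n+1))⁻¹ by positivity)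
    refine h2.trans (le_of_eq ?_)
    rw [inv_pow]
    field_simp
    ring

section
variable {E : Type*} [NormedAddCommGroup E] [NormedSpace ℝ E] [ProperSpace E]

lemma H_bounds (d : ℕ) (H : E → E) (hc : Continuous H)
    (hh : ∀ (t : ℝ) z, H (t • z) = t ^ d • H z) (h0 : ∀ z, H z = 0 → z = 0) :
    ∃ m M : ℝ, 0 < m ∧ 0 < M ∧ ∀ z, z ≠ 0 → m * ‖z‖ ^ d ≤ ‖H z‖ ∧ ‖H z‖ ≤ M * ‖z‖ ^ d := by
  have hcomp := isCompact_sphere (0 : E) 1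
  obtain ⟨M, hM⟩ := hcomp.exists_bound_of_continuousOn hc.continuousOn
  have hm : ∃ m : ℝ, 0 < m ∧ ∀ z ∈ Metric.sphere (0 : E) 1, m ≤ ‖H z‖ := by
    rcases (Metric.sphere (0 : E) 1).eq_empty_or_nonempty with h | h
    · exact ⟨1, one_pos, by simp [h]⟩
    · obtain ⟨x, hx, hmin⟩ := hcomp.exists_isMinOn h hc.norm.continuousOn
      refine ⟨‖H x‖, ?_, fun z hz => hmin hz⟩
      rw [norm_pos_iff]
      intro hx0
      have := h0 x hx0
      subst this
      simp at hx
  obtain ⟨m, hm, hmz⟩ := hm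
  refine ⟨m, max M 1, hm, by positivity, fun z hz => ?_⟩
  have hz' : 0 < ‖z‖ := norm_pos_iff.2 hz
  have hs : ‖z‖⁻¹ • z ∈ Metric.sphere (0 : E) 1 := by
    simp [norm_smul, hz]
  have e : H z = ‖z‖ ^ d • H (‖z‖⁻¹ • z) := by
    rw [← hh, smul_smul, mul_inv_cancel₀ hz'.ne', one_smul]
  have e' : ‖H z‖ = ‖z‖ ^ d * ‖H (‖z‖⁻¹ • z)‖ := by
    conv_lhs => rw [e]
    rw [norm_smul]; simp
  rw [e', mul_comm m, mul_comm (max M 1)]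
  constructor
  · gcongr; exact hmz _ hs
  · gcongr; exact (hM _ hs).trans (le_max_left _ _)

lemma H_close (d : ℕ) (H : E → E) (hc : Continuous H)
    (hh : ∀ (t : ℝ) z, H (t • z) = t ^ d • H z) (h0 : ∀ z, H z = 0 → z = 0)
    (ε : ℝ) (hε : 0 < ε) : ∃ δ > 0, ∀ a b, ‖a - b‖ ≤ δ * ‖b‖ → ‖H a - H b‖ ≤ ε * ‖H b‖ := by
  obtain ⟨m, M, hm, hM, hb⟩ := H_bounds d H hc hh h0
  have huc := (isCompact_closedBall (0 : E) 2).uniformContinuousOn_of_continuous hc.continuousOn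
  rw [Metric.uniformContinuousOn_iff] at huc
  obtain ⟨δ, hδ, hu⟩ := huc (ε * m) (by positivity)
  refine ⟨min (δ / 2) 1, by positivity, fun a b hab => ?_⟩
  by_cases hbz : b = 0
  · subst hbz
    have : a = 0 := by simpa using hab
    subst this
    simp; positivity
  have hz' : 0 < ‖b‖ := norm_pos_iff.2 hbz
  have e : ∀ z, H z = ‖b‖ ^ d • H (‖b‖⁻¹ • z) := fun z => by
    rw [← hh, smul_smul, mul_inv_cancel₀ hz'.ne', one_smul]
  have h1 : ‖‖b‖⁻¹ • b‖ = 1 := by simp [norm_smul, hbz]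
  have h2 : ‖‖b‖⁻¹ • a - ‖b‖⁻¹ • b‖ ≤ min (δ / 2) 1 := by
    rw [← smul_sub, norm_smul, norm_inv, norm_norm, inv_mul_le_iff₀ hz', mul_comm]
    exact hab
  have h3 : ‖‖b‖⁻¹ • a‖ ≤ 2 := by
    have := norm_le_norm_add_norm_sub' (‖b‖⁻¹ • a) (‖b‖⁻¹ • b)
    have := h2.trans (min_le_right _ _)
    linarith
  have h4 := hu (‖b‖⁻¹ • a) (by simpa using h3) (‖b‖⁻¹ • b) (by simp [h1])
    (by rw [dist_eq_norm]; have := h2.trans (min_le_left _ _); linarith)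
  rw [dist_eq_norm] at h4
  have h5 : ‖H a - H b‖ = ‖b‖ ^ d * ‖H (‖b‖⁻¹ • a) - H (‖b‖⁻¹ • b)‖ := by
    rw [e a, e b, ← smul_sub, norm_smul]; simp
  rw [h5]
  calc _ ≤ ‖b‖ ^ d * (ε * m) := by gcongr
    _ = ε * (m * ‖b‖ ^ d) := by ring
    _ ≤ _ := by gcongr; exact (hb b hbz).1

open Asymptotics

lemma main_abs (d : ℕ) (hd : 2 ≤ d) (f H : E → E) (hc : Continuous H)
    (hh : ∀ (t : ℝ) z, H (t • z) = t ^ d • H z) (h0 : ∀ z, H z = 0 → z = 0)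
    (K : ℝ) (hK : ∀ z, 1 ≤ ‖z‖ → ‖f z - H z‖ ≤ K * ‖z‖ ^ (d - 1))
    (G Gh : E → ℝ)
    (hG : ∀ z, Tendsto (fun n => ((d : ℝ) ^ n)⁻¹ * Real.log (max ‖f^[n] z‖ 1)) atTop (nhds (G z)))
    (hGh : ∀ z, z ≠ 0 → Tendsto (fun n => ((d : ℝ) ^ n)⁻¹ * Real.log ‖H^[n] z‖) atTop
      (nhds (Gh z))) :
    Tendsto (fun z => G z - Gh z) (comap (fun z : E => ‖z‖) atTop) (nhds 0) := by
  have hdR : (2 : ℝ) ≤ d := by exact_mod_cast hd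
  obtain ⟨m, M, hm, hM, hb⟩ := H_bounds d H hc hh h0
  set l := comap (fun z : E => ‖z‖) atTop with hl
  have hn : Tendsto (fun z : E => ‖z‖) l atTop := tendsto_comap
  -- log bound for H
  have hHlog : ∃ C, ∀ z, z ≠ 0 → |Real.log ‖H z‖ - d * Real.log ‖z‖| ≤ C := by
    refine ⟨max |Real.log m| |Real.log M|, fun z hz => ?_⟩
    have hz' : 0 < ‖z‖ := norm_pos_iff.2 hz
    obtain ⟨h1, h2⟩ := hb z hz
    have a1 := Real.log_le_log (by positivity) h1
    have a2 := Real.log_le_log (lt_of_lt_of_le (by positivity) h1) h2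
    rw [Real.log_mul hm.ne' (by positivity), Real.log_pow] at a1
    rw [Real.log_mul hM.ne' (by positivity), Real.log_pow] at a2
    rw [abs_le]
    have b1 := neg_abs_le (Real.log m)
    have b2 := le_abs_self (Real.log M)
    have b3 := le_max_left |Real.log m| |Real.log M|
    have b4 := le_max_right |Real.log m| |Real.log M|
    constructor <;> linarith
  obtain ⟨C, hC⟩ := hHlog
  -- f ~ H
  have hfH : ∀ ε > 0, ∀ᶠ z in l, ‖f z - H z‖ ≤ ε * ‖H z‖ := by
    intro ε hε
    filter_upwards [hn.eventually_ge_atTop 1, hn.eventually_ge_atTop (K / (ε * m))] with z h1 h2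
    have hz : z ≠ 0 := by rintro rfl; simp at h1; linarith
    have hz' : 0 < ‖z‖ := norm_pos_iff.2 hz
    rw [div_le_iff₀ (by positivity)] at h2
    calc _ ≤ K * ‖z‖ ^ (d-1) := hK z h1
      _ ≤ ‖z‖ * (ε * m) * ‖z‖ ^ (d-1) := by gcongr
      _ = ε * (m * ‖z‖ ^ (d - 1 + 1)) := by ring
      _ = ε * (m * ‖z‖ ^ d) := by rw [Nat.sub_add_cancel (by omega)]
      _ ≤ _ := by gcongr; exact (hb z hz).1
  have hlogclose : ∀ a b : E, b ≠ 0 → ‖a - b‖ ≤ 1/2 * ‖b‖ →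
      |Real.log ‖a‖ - Real.log ‖b‖| ≤ Real.log 2 := by
    intro a b hb0 hab
    have hb' : 0 < ‖b‖ := norm_pos_iff.2 hb0
    have c1 := norm_sub_norm_le a b
    have c2 := norm_sub_norm_le b a
    rw [norm_sub_rev] at c2
    have a1 := Real.log_le_log (x := ‖b‖ / 2) (y := ‖a‖) (by positivity) (by linarith)
    have a2 := Real.log_le_log (x := ‖a‖) (y := 2 * ‖b‖) (by linarith) (by linarith)
    rw [Real.log_div hb'.ne' two_ne_zero] at a1
    rw [Real.log_mul two_ne_zero hb'.ne'] at a2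
    rw [abs_le]; constructor <;> linarith
  have hev : ∀ᶠ z in l, ‖z‖ ≤ ‖f z‖ ∧ |Real.log ‖f z‖ - d * Real.log ‖z‖| ≤ C + Real.log 2 := by
    filter_upwards [hn.eventually_ge_atTop 1, hn.eventually_ge_atTop (2 / m),
      hfH (1/2) (by norm_num)] with z h1 h2 h3
    have hz : z ≠ 0 := by rintro rfl; simp at h1; linarith
    have hHz : H z ≠ 0 := fun h => hz (h0 z h)
    rw [div_le_iff₀ hm] at h2
    constructor
    · have c2 := norm_sub_norm_le (H z) (f z)
      rw [norm_sub_rev] at c2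
      have c3 := (hb z hz).1
      have c4 : ‖z‖ ^ 2 ≤ ‖z‖ ^ d := pow_le_pow_right₀ h1 hd
      nlinarith
    · have c1 := abs_le.1 (hlogclose _ _ hHz h3)
      have c2 := abs_le.1 (hC z hz)
      rw [abs_le]; constructor <;> linarith
  obtain ⟨R, hR1, hR⟩ : ∃ R : ℝ, 1 ≤ R ∧ ∀ z, R ≤ ‖z‖ →
      ‖z‖ ≤ ‖f z‖ ∧ |Real.log ‖f z‖ - d * Real.log ‖z‖| ≤ C + Real.log 2 := by
    rw [hl, eventually_comap] at hev
    obtain ⟨R, hR⟩ := eventually_atTop.1 hev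
    exact ⟨max R 1, le_max_right _ _, fun z hz => hR _ ((le_max_left _ _).trans hz) z rfl⟩
  have hfl : Tendsto f l l := by
    rw [hl, tendsto_comap_iff]
    refine tendsto_atTop_mono' _ ?_ hn
    filter_upwards [hn.eventually_ge_atTop R] with z hz using (hR z hz).1
  -- iterates
  have hit : ∀ n : ℕ, ∀ ε > 0, ∀ᶠ z in l, ‖f^[n] z - H^[n] z‖ ≤ ε * ‖H^[n] z‖ := by
    intro n
    induction n with
    | zero => intro ε hε; simp; exact Eventually.of_forall fun z => by positivity
    | succ n ih =>
      intro ε hε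
      obtain ⟨δ, hδ, hcl⟩ := H_close d H hc hh h0 (min (ε/3) 1) (by positivity)
      filter_upwards [ih δ hδ, (hfl.iterate n).eventually (hfH (ε/3) (by positivity))] with z h1 h2
      rw [Function.iterate_succ_apply', Function.iterate_succ_apply']
      have h3 := hcl _ _ h1
      set a := f^[n] z
      set b := H^[n] z
      have h4 : ‖H a - H b‖ ≤ ε / 3 * ‖H b‖ :=
        h3.trans (by gcongr; exact min_le_left _ _)
      have h5 : ‖H a - H b‖ ≤ 1 * ‖H b‖ :=
        h3.trans (by gcongr; exact min_le_right _ _)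
      have h6 : ‖H a‖ ≤ 2 * ‖H b‖ := by
        have := norm_sub_norm_le (H a) (H b)
        linarith
      have h7 : ‖f a - H a‖ ≤ ε / 3 * (2 * ‖H b‖) := h2.trans (by gcongr)
      have h8 := norm_sub_le_norm_sub_add_norm_sub (f a) (H a) (H b)
      linarith
  have hHn0 : ∀ z, z ≠ 0 → ∀ n, H^[n] z ≠ 0 := by
    intro z hz n
    induction n with
    | zero => simpa
    | succ n ih => rw [Function.iterate_succ_apply']; exact fun h => ih (h0 _ h)
  have hfnR : ∀ z, R ≤ ‖z‖ → ∀ n, R ≤ ‖f^[n] z‖ := by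
    intro z hz n
    induction n with
    | zero => simpa
    | succ n ih => rw [Function.iterate_succ_apply']; exact ih.trans (hR _ ih).1
  have hlogn : ∀ n : ℕ, ∀ᶠ z in l, |Real.log ‖f^[n] z‖ - Real.log ‖H^[n] z‖| ≤ Real.log 2 := by
    intro n
    filter_upwards [hn.eventually_ge_atTop R, hit n (1/2) (by norm_num)] with z h1 h2
    have hz : z ≠ 0 := by rintro rfl; simp at h1; linarith
    exact hlogclose _ _ (hHn0 z hz n) h2
  set A := (C + Real.log 2) / d / (1 - (d:ℝ)⁻¹)
  set B := C / d / (1 - (d:ℝ)⁻¹)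
  have hGb : ∀ z, R ≤ ‖z‖ → ∀ n, |((d:ℝ) ^ n)⁻¹ * Real.log ‖f^[n] z‖ - G z| ≤ A * (d:ℝ)⁻¹ ^ n := by
    intro z hz n
    refine seq_bound d hdR _ (fun n => Real.log ‖f^[n] z‖) _ ?_ ?_ n
    · intro n
      simp only [Function.iterate_succ_apply']
      exact (hR _ (hfnR z hz n)).2
    · refine (hG z).congr fun n => ?_
      rw [max_eq_left (hR1.trans (hfnR z hz n))]
  have hGhb : ∀ z, z ≠ 0 → ∀ n,
      |((d:ℝ) ^ n)⁻¹ * Real.log ‖H^[n] z‖ - Gh z| ≤ B * (d:ℝ)⁻¹ ^ n := by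
    intro z hz n
    refine seq_bound d hdR _ (fun n => Real.log ‖H^[n] z‖) _ ?_ (hGh z hz) n
    intro n
    simp only [Function.iterate_succ_apply']
    exact hC _ (hHn0 z hz n)
  have hlim : Tendsto (fun n : ℕ => (A + B + Real.log 2) * (d:ℝ)⁻¹ ^ n) atTop (nhds 0) := by
    have := (tendsto_pow_atTop_nhds_zero_of_lt_one (r := (d:ℝ)⁻¹) (by positivity)
      (inv_lt_one_of_one_lt₀ (by linarith))).const_mul (A + B + Real.log 2)
    simpa using this
  rw [Metric.tendsto_nhds]
  intro ε hε
  obtain ⟨n, hnε⟩ := (hlim.eventually (gt_mem_nhds hε)).exists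
  filter_upwards [hn.eventually_ge_atTop R, hlogn n] with z h1 h2
  have hz : z ≠ 0 := by rintro rfl; simp at h1; linarith
  rw [Real.dist_eq, sub_zero]
  have e1 := abs_le.1 (hGb z h1 n)
  have e2 := abs_le.1 (hGhb z hz n)
  have e3 : |((d:ℝ) ^ n)⁻¹ * Real.log ‖f^[n] z‖ - ((d:ℝ) ^ n)⁻¹ * Real.log ‖H^[n] z‖|
      ≤ Real.log 2 * (d:ℝ)⁻¹ ^ n := by
    rw [← mul_sub, abs_mul, abs_of_pos (by positivity), inv_pow, mul_comm]
    gcongr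
  have e3 := abs_le.1 e3
  refine lt_of_le_of_lt ?_ hnε
  rw [abs_le]; constructor <;> linarith

end

lemma poly_bound {k : ℕ} (p : MvPolynomial (Fin k) ℂ) (m : ℕ)
    (hp : ∀ s ∈ p.support, s.degree ≤ m) :
    ∃ K : ℝ, 0 ≤ K ∧ ∀ z : EuclideanSpace ℂ (Fin k), 1 ≤ ‖z‖ →
      ‖MvPolynomial.eval (fun i => z i) p‖ ≤ K * ‖z‖ ^ m := by
  refine ⟨∑ s ∈ p.support, ‖p.coeff s‖, by positivity, fun z hz => ?_⟩
  rw [MvPolynomial.eval_eq, Finset.sum_mul]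
  refine (norm_sum_le _ _).trans (Finset.sum_le_sum fun s hs => ?_)
  rw [norm_mul, norm_prod]
  gcongr
  calc ∏ i ∈ s.support, ‖z i ^ s i‖ ≤ ∏ i ∈ s.support, ‖z‖ ^ s i := by
        refine Finset.prod_le_prod (fun _ _ => norm_nonneg _) fun i _ => ?_
        rw [norm_pow]
        gcongr
        exact PiLp.norm_apply_le z i
    _ = ‖z‖ ^ s.degree := by rw [Finset.prod_pow_eq_pow_sum]; rfl
    _ ≤ _ := pow_le_pow_right₀ hz (hp s hs)

lemma hom_eval {k d : ℕ} (p : MvPolynomial (Fin k) ℂ) (t : ℂ) (x : Fin k → ℂ) :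
    MvPolynomial.eval (fun i => t * x i) (MvPolynomial.homogeneousComponent d p)
      = t ^ d * MvPolynomial.eval x (MvPolynomial.homogeneousComponent d p) := by
  rw [MvPolynomial.eval_eq, MvPolynomial.eval_eq, Finset.mul_sum]
  refine Finset.sum_congr rfl fun s hs => ?_
  have hs' : s.degree = d := by
    rw [MvPolynomial.mem_support_iff, MvPolynomial.coeff_homogeneousComponent] at hs
    by_contra h
    simp [h] at hs
  simp only [mul_pow, Finset.prod_mul_distrib]
  rw [Finset.prod_pow_eq_pow_sum, show ∑ i ∈ s.support, s i = d from hs']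
  ring

lemma diff_bound {k d : ℕ} (hd : 2 ≤ d) (F : Fin k → MvPolynomial (Fin k) ℂ)
    (hdeg : ∀ i, (F i).totalDegree ≤ d) :
    ∃ K : ℝ, ∀ z : EuclideanSpace ℂ (Fin k), 1 ≤ ‖z‖ →
      ‖evalMap F z - evalMap (fun i => MvPolynomial.homogeneousComponent d (F i)) z‖
        ≤ K * ‖z‖ ^ (d - 1) := by
  have h : ∀ i, ∃ K : ℝ, 0 ≤ K ∧ ∀ z : EuclideanSpace ℂ (Fin k), 1 ≤ ‖z‖ →
      ‖MvPolynomial.eval (fun i => z i) (F i - MvPolynomial.homogeneousComponent d (F i))‖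
        ≤ K * ‖z‖ ^ (d - 1) := by
    intro i
    refine poly_bound _ _ fun s hs => ?_
    rw [MvPolynomial.mem_support_iff, MvPolynomial.coeff_sub,
      MvPolynomial.coeff_homogeneousComponent] at hs
    by_cases hsd : s.degree = d
    · simp [hsd] at hs
    · rw [if_neg hsd, sub_zero] at hs
      have h1 : s.degree ≤ (F i).totalDegree :=
        MvPolynomial.le_totalDegree (MvPolynomial.mem_support_iff.2 hs)
      have := hdeg i
      omega
  choose K hK0 hK using h
  refine ⟨∑ i, K i, fun z hz => ?_⟩
  set w := evalMap F z - evalMap (fun i => MvPolynomial.homogeneousComponent d (F i)) z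
  have hw : ∀ i, ‖w i‖ ≤ K i * ‖z‖ ^ (d - 1) := by
    intro i
    have := hK i z hz
    rw [map_sub] at this
    exact this
  calc ‖w‖ ≤ ∑ i, ‖w i‖ := by
        rw [EuclideanSpace.norm_eq]
        refine Real.sqrt_le_iff.2 ⟨by positivity, ?_⟩
        exact Finset.sum_sq_le_sq_sum_of_nonneg fun i _ => norm_nonneg _
    _ ≤ _ := by rw [Finset.sum_mul]; exact Finset.sum_le_sum fun i _ => hw i

/-- For a regular polynomial endomorphism `f` of degree `d ≥ 2` with Green function
`G(z) = lim d^{-n} log⁺|f^n z|` and homogeneous part `f_h` with homogeneous Green function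
`G_h(z) = lim d^{-n} log|f_h^n z|`, one has `G(z) − G_h(z) → 0` as `|z| → ∞`. -/
theorem green_function_asymptotics {k d : ℕ} (hk : 1 ≤ k) (hd : 2 ≤ d)
    (F : Fin k → MvPolynomial (Fin k) ℂ)
    (hdeg : ∀ i, (F i).totalDegree ≤ d)
    (hreg : ∀ z : EuclideanSpace ℂ (Fin k),
      evalMap (fun i => MvPolynomial.homogeneousComponent d (F i)) z = 0 → z = 0)
    (G Gh : EuclideanSpace ℂ (Fin k) → ℝ)
    (hG : ∀ z : EuclideanSpace ℂ (Fin k),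
      Tendsto (fun n => ((d : ℝ) ^ n)⁻¹ * Real.log (max ‖(evalMap F)^[n] z‖ 1)) atTop
        (nhds (G z)))
    (hGh : ∀ z : EuclideanSpace ℂ (Fin k), z ≠ 0 →
      Tendsto
        (fun n => ((d : ℝ) ^ n)⁻¹ *
          Real.log ‖(evalMap (fun i => MvPolynomial.homogeneousComponent d (F i)))^[n] z‖)
        atTop (nhds (Gh z))) :
    Tendsto (fun z : EuclideanSpace ℂ (Fin k) => G z - Gh z)
      (Filter.comap (fun z : EuclideanSpace ℂ (Fin k) => ‖z‖) Filter.atTop)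
      (nhds 0) := by
  obtain ⟨K, hK⟩ := diff_bound hd F hdeg
  refine main_abs d hd (evalMap F) _ ?_ ?_ hreg K hK G Gh hG hGh
  · unfold evalMap
    refine (PiLp.continuous_toLp 2 _).comp (continuous_pi fun i => ?_)
    exact (MvPolynomial.continuous_eval _).comp (PiLp.continuous_ofLp 2 _)
  · intro t z
    ext i
    have := hom_eval (d := d) (F i) (t : ℂ) (fun i => z i)
    simpa [evalMap, Pi.smul_def] using this
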